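/- Let Λ = (λ_1,…,λ_n), λ_i ∈ ℝ^k, be weakly hyperbolic, let Λ' = (λ_1, λ_1, λ_2, …, λ_n), and write Z' = Z(Λ') ⊆ ℝ^{n+1} with coordinates (x_0, x_1, …, x_n). Set Z_+ = Z(Λ) ∩ {x_1 ≥ 0}. Then the map r(x_0, x_1, x_2, …, x_n) = (√(x_0² + x_1²), x_2, …, x_n) is a continuous retraction of Z' onto Z_+: for every x ∈ Z' one has r(x) ∈ Z_+, and r(0, x_1, …, x_n) = (x_1, …, x_n) for every (x_1,…,x_n) ∈ Z_+. -/

import Mathlib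

open scoped BigOperators

/-- The intersection of quadrics `Z(Λ)` for a configuration `Λ` of vectors in `ℝ^k`. -/
def ZReal {n k : ℕ} (Λ : Fin n → Fin k → ℝ) : Set (Fin n → ℝ) :=
  {x | (∑ i, (x i) ^ 2 • Λ i) = 0 ∧ (∑ i, (x i) ^ 2) = 1}

/-- `Λ` is weakly hyperbolic. -/
def WeaklyHyperbolic {n k : ℕ} (Λ : Fin n → Fin k → ℝ) : Prop :=
  ∀ J : Finset (Fin n), J.card ≤ k → (0 : Fin k → ℝ) ∉ convexHull ℝ (Λ '' ↑J)

/-- `Λ' = (λ_1, λ_1, λ_2, …, λ_n)`: the configuration with `λ_1` repeated. -/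
def doubled {n k : ℕ} (Λ : Fin (n + 1) → Fin k → ℝ) : Fin (n + 2) → Fin k → ℝ :=
  Fin.cons (Λ 0) Λ

/-- The half manifold `Z_+ = Z(Λ) ∩ {x_1 ≥ 0}`. -/
def ZPlus {n k : ℕ} (Λ : Fin (n + 1) → Fin k → ℝ) : Set (Fin (n + 1) → ℝ) :=
  {x | x ∈ ZReal Λ ∧ 0 ≤ x 0}

/-- The retraction `r(x_0, x_1, x_2, …, x_n) = (√(x_0² + x_1²), x_2, …, x_n)`, where the
coordinates of `ℝ^{n+1}` are `(x_0, x_1, …, x_n)` (index `0 ↦ x_0`, index `i+1 ↦ x_i`). -/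
noncomputable def retractMap {n : ℕ} (x : Fin (n + 2) → ℝ) : Fin (n + 1) → ℝ :=
  fun i => if i = 0 then Real.sqrt (x 0 ^ 2 + x 1 ^ 2) else x i.succ

@[simp]
theorem retractMap_zero {n : ℕ} (x : Fin (n + 2) → ℝ) :
    retractMap x 0 = Real.sqrt (x 0 ^ 2 + x 1 ^ 2) := by
  simp [retractMap]

@[simp]
theorem retractMap_succ {n : ℕ} (x : Fin (n + 2) → ℝ) (i : Fin n) :
    retractMap x i.succ = x i.succ.succ := by
  simp [retractMap]

theorem continuous_retractMap {n : ℕ} : Continuous (retractMap (n := n)) := by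
  refine continuous_pi fun i => ?_
  cases i using Fin.cases with
  | zero => simp only [retractMap_zero]; fun_prop
  | succ i => simp only [retractMap_succ]; fun_prop

/-- Replacing the first two coordinates by their Euclidean norm preserves every sum of squares
weighted by a family whose first two members coincide. -/
theorem sum_sq_smul_retractMap {n : ℕ} {M : Type*} [AddCommGroup M] [Module ℝ M]
    (v : Fin (n + 1) → M) (x : Fin (n + 2) → ℝ) :
    ∑ i, retractMap x i ^ 2 • v i =
      ∑ i, x i ^ 2 • (Fin.cons (v 0) v : Fin (n + 2) → M) i := by
  have h : 0 ≤ x 0 ^ 2 + x 1 ^ 2 := by positivity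
  simp only [Fin.sum_univ_succ, retractMap_zero, retractMap_succ, Fin.cons_zero, Fin.cons_succ,
    Fin.succ_zero_eq_one, Real.sq_sqrt h, add_smul, add_assoc]

theorem sum_sq_retractMap {n : ℕ} (x : Fin (n + 2) → ℝ) :
    ∑ i, retractMap x i ^ 2 = ∑ i, x i ^ 2 := by
  have h : 0 ≤ x 0 ^ 2 + x 1 ^ 2 := by positivity
  simp only [Fin.sum_univ_succ, retractMap_zero, retractMap_succ, Fin.succ_zero_eq_one,
    Real.sq_sqrt h, add_assoc]

theorem retractMap_mem_ZPlus {n k : ℕ} {Λ : Fin (n + 1) → Fin k → ℝ} {x : Fin (n + 2) → ℝ}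
    (hx : x ∈ ZReal (doubled Λ)) : retractMap x ∈ ZPlus Λ := by
  refine ⟨⟨(sum_sq_smul_retractMap Λ x).trans hx.1, (sum_sq_retractMap x).trans hx.2⟩, ?_⟩
  rw [retractMap_zero]
  exact Real.sqrt_nonneg _

theorem retractMap_cons_zero {n : ℕ} {p : Fin (n + 1) → ℝ} (hp : 0 ≤ p 0) :
    retractMap (Fin.cons 0 p) = p := by
  funext i
  cases i using Fin.cases with
  | zero =>
    rw [retractMap_zero, ← Fin.succ_zero_eq_one, Fin.cons_zero, Fin.cons_succ]
    simp [Real.sqrt_sq hp]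
  | succ i => rw [retractMap_succ, Fin.cons_succ]

/-- `r(x_0, x_1, x_2, …, x_n) = (√(x_0² + x_1²), x_2, …, x_n)` is a continuous retraction of
`Z' = Z(Λ')` onto `Z_+`, where `Z_+` is embedded in `Z'` via `(x_1,…,x_n) ↦ (0,x_1,…,x_n)`. -/
theorem retraction_real {n k : ℕ} (hk : 1 ≤ k)
    (Λ : Fin (n + 1) → Fin k → ℝ) (hΛ : WeaklyHyperbolic Λ) :
    Continuous (retractMap (n := n)) ∧
    (∀ x ∈ ZReal (doubled Λ), retractMap x ∈ ZPlus Λ) ∧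
    (∀ p ∈ ZPlus Λ, retractMap (Fin.cons 0 p) = p) :=
  ⟨continuous_retractMap, fun _ => retractMap_mem_ZPlus, fun _ hp => retractMap_cons_zero hp.2⟩
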